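/- arXiv:1201.2015 — 2 statements merged into one kernel-verified Lean document; each statement's English description precedes it below -/
import Mathlib

section
/- Let n ≥ 3 be an integer. Define h(z) = ∫₀^z (1−ζⁿ)^{−2/n} (1−ζ^{2n})^{−1} dζ and g(z) = ∫₀^z ζ^{2n} (1−ζⁿ)^{−2/n} (1−ζ^{2n})^{−1} dζ for z ∈ 𝔻 (these are the shears of the regular n-gon mapping φ(z) = ∫₀^z (1−ζⁿ)^{−2/n} dζ with dilatation ω(z) = z^{2n}). Then the harmonic function f = h + conj(g) is injective on 𝔻 and f(𝔻) is convex in the horizontal direction. -/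
open Complex Set
open scoped Real

noncomputable section

/-- The open unit disk in the complex plane. -/
def unitDisk : Set ℂ := Metric.ball 0 1

/-- A set is convex in the horizontal direction (CHD) if its intersection with
every horizontal line is connected (possibly empty). -/
def IsCHD (Ω : Set ℂ) : Prop := ∀ t : ℝ, IsPreconnected {z | z ∈ Ω ∧ z.im = t}

/-- Integral of `f` along the line segment from `0` to `z`. -/
def segInt (f : ℂ → ℂ) (z : ℂ) : ℂ := ∫ t in (0:ℝ)..1, z * f ((t : ℂ) * z)

/-- Pochhammer symbol `(a)_m = a (a+1) ⋯ (a+m-1)`. -/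
def poch (a : ℂ) (m : ℕ) : ℂ := ∏ i ∈ Finset.range m, (a + i)

/-- Appell's first hypergeometric function `F₁(a, b₁, b₂; c; x, y)`. -/
def appellF1 (a b₁ b₂ c x y : ℂ) : ℂ :=
  ∑' (k : ℕ) (l : ℕ),
    poch a (k + l) * poch b₁ k * poch b₂ l /
      (poch c (k + l) * (Nat.factorial k : ℂ) * (Nat.factorial l : ℂ)) * x ^ k * y ^ l

open Filter Topology

theorem hasDerivAt_segInt {f : ℂ → ℂ} (hf : DifferentiableOn ℂ f unitDisk) {z : ℂ}
    (hz : z ∈ unitDisk) : HasDerivAt (segInt f) (f z) z := by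
  obtain ⟨F, hF⟩ := DifferentiableOn.isExactOn_ball hf
  have key : ∀ w ∈ unitDisk, segInt f w = F w - F 0 := by
    intro w hw
    have hmem : ∀ t ∈ Set.uIcc (0 : ℝ) 1, (t : ℂ) * w ∈ unitDisk := by
      intro t ht
      rw [Set.uIcc_of_le zero_le_one] at ht
      simp only [unitDisk, mem_ball_zero_iff, norm_mul, norm_real, Real.norm_eq_abs,
        abs_of_nonneg ht.1] at hw ⊢
      nlinarith [ht.2, norm_nonneg w]
    have hd : ∀ t ∈ Set.uIcc (0 : ℝ) 1,
        HasDerivAt (fun t : ℝ => F ((t : ℂ) * w)) (w * f ((t : ℂ) * w)) t := by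
      intro t ht
      have h1 : HasDerivAt (fun t : ℝ => (t : ℂ) * w) w t := by
        simpa using (ofRealCLM.hasDerivAt (x := t)).mul_const w
      rw [mul_comm w]
      exact (hF _ (hmem t ht)).comp t h1
    have := intervalIntegral.integral_eq_sub_of_hasDerivAt hd <|
      ContinuousOn.intervalIntegrable <|
        continuousOn_const.mul (hf.continuousOn.comp (by fun_prop) hmem)
    simpa [segInt] using this
  refine ((hF z hz).sub_const (F 0)).congr_of_eventuallyEq ?_
  filter_upwards [Metric.isOpen_ball.mem_nhds hz] with w hw using key w hw

/-- Second-order obstruction to a local maximum of the norm along a curve. -/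
theorem not_isLocalMax_norm_sq {E : Type*} [NormedAddCommGroup E] [InnerProductSpace ℝ E]
    {γ γ' : ℝ → E} {γ'' : E} {t : ℝ} (hγ : ∀ᶠ s in 𝓝 t, HasDerivAt γ (γ' s) s)
    (hγ' : HasDerivAt γ' γ'' t)
    (hpos : inner ℝ (γ t) (γ' t) = 0 → 0 < inner ℝ (γ t) γ'' + inner ℝ (γ' t) (γ' t)) :
    ¬ IsLocalMax (fun s => ‖γ s‖ ^ 2) t := by
  intro hmax
  have hd : deriv (fun s => ‖γ s‖ ^ 2) =ᶠ[𝓝 t] fun s => 2 * inner ℝ (γ s) (γ' s) := by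
    filter_upwards [hγ] with s hs using hs.norm_sq.deriv
  have h0 : inner ℝ (γ t) (γ' t) = 0 := by
    have := hd.eq_of_nhds
    rw [hmax.deriv_eq_zero] at this
    linarith
  have hdd : deriv (deriv (fun s => ‖γ s‖ ^ 2)) t
      = 2 * (inner ℝ (γ t) γ'' + inner ℝ (γ' t) (γ' t)) := by
    rw [hd.deriv_eq]
    exact ((hγ.self_of_nhds.inner ℝ hγ').const_mul 2).deriv
  have hmin : IsLocalMin (fun s => ‖γ s‖ ^ 2) t :=
    isLocalMin_of_deriv_deriv_pos (by rw [hdd]; linarith [hpos h0]) hmax.deriv_eq_zero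
      hγ.self_of_nhds.norm_sq.continuousAt
  have hconst : (fun s => ‖γ s‖ ^ 2) =ᶠ[𝓝 t] fun _ => ‖γ t‖ ^ 2 := by
    filter_upwards [hmax, hmin] with s h1 h2 using le_antisymm h1 h2
  have hz : deriv (deriv (fun s => ‖γ s‖ ^ 2)) t = 0 := by
    rw [hconst.deriv.deriv_eq]
    simp
  linarith [hpos h0, hdd, hz]

/-- An injective holomorphic function with nonvanishing derivative on an open set is an open
partial homeomorphism. -/
theorem exists_openPartialHomeomorph_of_injOn {φ φ' : ℂ → ℂ} {U : Set ℂ} (hU : IsOpen U)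
    (hφ : ∀ z ∈ U, HasDerivAt φ (φ' z) z) (h0 : ∀ z ∈ U, φ' z ≠ 0) (hinj : InjOn φ U) :
    ∃ e : OpenPartialHomeomorph ℂ ℂ, e.source = U ∧ e.target = φ '' U ∧ ⇑e = φ := by
  refine ⟨OpenPartialHomeomorph.ofContinuousOpenRestrict (hinj.toPartialEquiv φ U)
    (fun z hz => (hφ z hz).continuousAt.continuousWithinAt) ?_ hU, rfl, rfl, rfl⟩
  refine IsOpenMap.of_nhds_le fun x => ?_
  have hx : (x : ℂ) ∈ U := x.2
  have hs : HasStrictDerivAt φ (φ' x) x := by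
    rw [← (hφ x hx).deriv]
    exact (DifferentiableOn.analyticAt
      (fun z hz => (hφ z hz).differentiableAt.differentiableWithinAt)
      (hU.mem_nhds hx)).hasStrictDerivAt
  have h1 : map (Subtype.val : U → ℂ) (𝓝 x) = 𝓝 (x : ℂ) :=
    map_nhds_subtype_coe_eq_nhds hx (hU.mem_nhds hx)
  change 𝓝 (φ x) ≤ map (φ ∘ (Subtype.val : U → ℂ)) (𝓝 x)
  rw [← Filter.map_map, h1, hs.map_nhds_eq (h0 x hx)]

theorem sub_pos_of_hasDerivAt_pos {u u' : ℝ → ℝ}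
    (hu : ∀ t ∈ Icc (0 : ℝ) 1, HasDerivAt u (u' t) t) (hpos : ∀ t ∈ Icc (0 : ℝ) 1, 0 < u' t) :
    u 0 < u 1 := by
  refine strictMonoOn_of_deriv_pos (convex_Icc 0 1)
    (fun t ht => (hu t ht).continuousAt.continuousWithinAt) (fun t ht => ?_)
    (left_mem_Icc.2 zero_le_one) (right_mem_Icc.2 zero_le_one) zero_lt_one
  rw [(hu t (interior_subset ht)).deriv]
  exact hpos t (interior_subset ht)

/-- The Noshiro–Warschawski criterion. -/
theorem injOn_of_re_deriv_pos {φ φ' : ℂ → ℂ} {U : Set ℂ} (hU : Convex ℝ U)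
    (hφ : ∀ z ∈ U, HasDerivAt φ (φ' z) z) (hpos : ∀ z ∈ U, 0 < (φ' z).re) : InjOn φ U := by
  intro a ha b hb hab
  by_contra hne
  have hd : b - a ≠ 0 := sub_ne_zero.2 (Ne.symm hne)
  have hmem : ∀ t ∈ Icc (0 : ℝ) 1, a + (t : ℂ) * (b - a) ∈ U := by
    intro t ht
    have := hU.add_smul_sub_mem ha hb ht
    simpa using this
  have h1 : ∀ t ∈ Icc (0 : ℝ) 1,
      HasDerivAt (fun t : ℝ => (φ (a + (t : ℂ) * (b - a)) / (b - a)).re)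
        (φ' (a + (t : ℂ) * (b - a))).re t := by
    intro t ht
    have h2 : HasDerivAt (fun t : ℝ => a + (t : ℂ) * (b - a)) (b - a) t := by
      simpa using ((ofRealCLM.hasDerivAt (x := t)).mul_const (b - a)).const_add a
    have h3 := (((hφ _ (hmem t ht)).comp t h2).div_const (b - a))
    rw [mul_div_cancel_right₀ _ hd] at h3
    exact reCLM.hasFDerivAt.comp_hasDerivAt t h3
  have := sub_pos_of_hasDerivAt_pos h1 (fun t ht => hpos _ (hmem t ht))
  simp [hab] at this

theorem inner_add_inner_pos_of_inner_eq_zero {z v q : ℂ} (hv : v ≠ 0) (hq : 0 < (1 - z * q).re)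
    (h : inner ℝ z v = 0) : 0 < inner ℝ z (q * v * v) + inner ℝ v v := by
  rw [Complex.inner] at h
  have h1 : (starRingEnd ℂ) z * v = -(z * (starRingEnd ℂ) v) := by
    apply Complex.ext
    · simp at h ⊢; linarith
    · simp; ring
  have h2 : (starRingEnd ℂ) z * (q * v * v) = (normSq v : ℂ) * (-(z * q)) := by
    rw [← mul_conj v]
    linear_combination q * v * h1
  rw [Complex.inner, Complex.inner, mul_comm (q * v * v), h2, re_ofReal_mul, mul_conj, ofReal_re]
  have := mul_pos (normSq_pos.2 hv) hq
  rw [sub_re, one_re, mul_sub, mul_one] at this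
  rw [neg_re]
  linarith

section Convexity

variable {e : OpenPartialHomeomorph ℂ ℂ} {P P' : ℂ → ℂ}

theorem hasDerivAt_symm_line (he : ∀ z ∈ e.source, HasDerivAt e (P z)⁻¹ z)
    (h0 : ∀ z ∈ e.source, P z ≠ 0) (c d : ℂ) {t : ℝ} (ht : c + (t : ℂ) * d ∈ e.target) :
    HasDerivAt (fun s : ℝ => e.symm (c + (s : ℂ) * d)) (P (e.symm (c + (t : ℂ) * d)) * d) t := by
  have hs := e.map_target ht
  have h1 : HasDerivAt (fun s : ℝ => c + (s : ℂ) * d) d t := by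
    simpa using ((ofRealCLM.hasDerivAt (x := t)).mul_const d).const_add c
  have h2 := e.hasDerivAt_symm ht (inv_ne_zero (h0 _ hs)) (he _ hs)
  rw [inv_inv] at h2
  exact h2.comp t h1

/-- Under the convexity condition `Re (1 + z φ'' / φ') > 0` (here `φ' = 1 / P`), the modulus of
the inverse of `φ` is maximal at an endpoint of each segment. -/
theorem norm_symm_le_of_mem_segment (he : ∀ z ∈ e.source, HasDerivAt e (P z)⁻¹ z)
    (hP : ∀ z ∈ e.source, HasDerivAt P (P' z) z) (h0 : ∀ z ∈ e.source, P z ≠ 0)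
    (hc : ∀ z ∈ e.source, 0 < (1 - z * (P' z / P z)).re) {a b : ℂ} {r : ℝ}
    (ha : a ∈ e.source) (hb : b ∈ e.source) (har : ‖a‖ ≤ r) (hbr : ‖b‖ ≤ r)
    (hseg : ∀ t ∈ Icc (0 : ℝ) 1, e a + (t : ℂ) * (e b - e a) ∈ e.target) :
    ∀ t ∈ Icc (0 : ℝ) 1, ‖e.symm (e a + (t : ℂ) * (e b - e a))‖ ≤ r := by
  set d := e b - e a with hd
  set γ : ℝ → ℂ := fun s => e.symm (e a + (s : ℂ) * d) with hγ
  have hγd : ∀ t ∈ Icc (0 : ℝ) 1, HasDerivAt γ (P (γ t) * d) t := fun t ht =>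
    hasDerivAt_symm_line he h0 _ _ (hseg t ht)
  have hγ0 : γ 0 = a := by simp [hγ, e.left_inv ha]
  have hγ1 : γ 1 = b := by simp [hγ, hd, e.left_inv hb]
  obtain ⟨t₀, ht₀, hmax⟩ := isCompact_Icc.exists_isMaxOn (nonempty_Icc.2 zero_le_one)
    (f := fun s => ‖γ s‖ ^ 2)
    (fun t ht => ((hγd t ht).continuousAt.norm.pow 2).continuousWithinAt)
  have hr : 0 ≤ r := (norm_nonneg a).trans har
  suffices h : ‖γ t₀‖ ≤ r by
    intro t ht
    have h1 : ‖γ t‖ ^ 2 ≤ ‖γ t₀‖ ^ 2 := hmax ht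
    exact (le_of_sq_le_sq h1 (norm_nonneg _)).trans h
  by_cases hd0 : d = 0
  · have : γ t₀ = a := by simp [hγ, hd0, e.left_inv ha]
    rwa [this]
  rcases eq_or_lt_of_le ht₀.1 with h | hlt0
  · rwa [← h, hγ0]
  rcases eq_or_lt_of_le ht₀.2 with h | hlt1
  · rwa [h, hγ1]
  exfalso
  have hs := e.map_target (hseg t₀ ht₀)
  have hnhds : Icc (0 : ℝ) 1 ∈ 𝓝 t₀ := Icc_mem_nhds hlt0 hlt1
  refine not_isLocalMax_norm_sq (γ' := fun s => P (γ s) * d)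
    (γ'' := P' (γ t₀) / P (γ t₀) * (P (γ t₀) * d) * (P (γ t₀) * d))
    (eventually_of_mem hnhds hγd) ?_ (fun h => ?_) (hmax.isLocalMax hnhds)
  · have h1 := ((hP _ hs).comp t₀ (hγd t₀ ht₀)).mul_const d
    refine h1.congr_deriv ?_
    have : P (γ t₀) ≠ 0 := h0 _ hs
    change P' (γ t₀) * (P (γ t₀) * d) * d = _
    field_simp
  · exact inner_add_inner_pos_of_inner_eq_zero (mul_ne_zero (h0 _ hs) hd0) (hc _ hs) h

/-- A univalent function on the unit disk with `Re (1 + z φ'' / φ') > 0` has convex image. -/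
theorem convex_target_of_re_pos (hsrc : e.source = unitDisk)
    (he : ∀ z ∈ e.source, HasDerivAt e (P z)⁻¹ z)
    (hP : ∀ z ∈ e.source, HasDerivAt P (P' z) z) (h0 : ∀ z ∈ e.source, P z ≠ 0)
    (hc : ∀ z ∈ e.source, 0 < (1 - z * (P' z / P z)).re) : Convex ℝ e.target := by
  have main : ∀ b ∈ e.source, ∀ a ∈ e.source, ∀ t ∈ Icc (0 : ℝ) 1,
      e a + (t : ℂ) * (e b - e a) ∈ e.target := by
    intro b hb
    set S : Set ℂ := {a | a ∈ e.source ∧ ∀ t ∈ Icc (0 : ℝ) 1,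
      e a + (t : ℂ) * (e b - e a) ∈ e.target} with hS
    suffices h : unitDisk ⊆ S from fun a ha => (h (hsrc ▸ ha)).2
    refine IsPreconnected.subset_of_closure_inter_subset
      (convex_ball (0 : ℂ) 1).isPreconnected ?_ ⟨b, hsrc ▸ hb, hb, ?_⟩ ?_
    · refine isOpen_iff_mem_nhds.2 fun a ha => ?_
      refine Filter.inter_mem (f := 𝓝 a) (e.open_source.mem_nhds ha.1) ?_
      refine isCompact_Icc.eventually_forall_of_forall_eventually fun t ht => ?_
      have hcont : ContinuousAt (fun p : ℂ × ℝ => e p.1 + (p.2 : ℂ) * (e b - e p.1)) (a, t) := by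
        have h1 : ContinuousAt (fun p : ℂ × ℝ => e p.1) (a, t) :=
          ContinuousAt.comp' (f := Prod.fst) (e.continuousAt ha.1) continuousAt_fst
        have h2 : ContinuousAt (fun p : ℂ × ℝ => (p.2 : ℂ)) (a, t) := by fun_prop
        exact h1.add (h2.mul (continuousAt_const.sub h1))
      exact hcont.eventually (e.open_target.mem_nhds (ha.2 t ht))
    · intro t _
      simpa using e.map_source hb
    · rintro a ⟨hacl, hau⟩
      have ha : a ∈ e.source := hsrc ▸ hau
      refine ⟨ha, fun t ht => ?_⟩
      have hb1 : ‖b‖ < 1 := by simpa [hsrc, unitDisk] using hb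
      have ha1 : ‖a‖ < 1 := by simpa [unitDisk] using hau
      obtain ⟨r, hr, hr1⟩ := exists_between (max_lt hb1 ha1)
      have hsub : Metric.closedBall (0 : ℂ) r ⊆ e.source := by
        rw [hsrc]
        exact Metric.closedBall_subset_ball hr1
      have hK : IsClosed (e '' Metric.closedBall (0 : ℂ) r) :=
        ((isCompact_closedBall 0 r).image_of_continuousOn (e.continuousOn.mono hsub)).isClosed
      have hcont : Tendsto (fun z => e z + (t : ℂ) * (e b - e z)) (𝓝 a)
          (𝓝 (e a + (t : ℂ) * (e b - e a))) := by
        have := e.continuousAt ha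
        exact (this.add (continuousAt_const.mul (continuousAt_const.sub this)))
      have hev : ∀ᶠ z in 𝓝 a, ‖z‖ < r :=
        continuous_norm.continuousAt.eventually_lt_const ((le_max_right _ _).trans_lt hr)
      have hfreq := (mem_closure_iff_frequently.1 hacl).and_eventually hev
      have hmem := hK.mem_of_frequently_of_tendsto (hfreq.mono fun z hz => ?_) hcont
      · obtain ⟨z, hz, hze⟩ := hmem
        rw [← hze]
        exact e.map_source (hsub hz)
      · obtain ⟨⟨hzs, hzt⟩, hzr⟩ := hz
        refine ⟨e.symm (e z + (t : ℂ) * (e b - e z)), ?_, e.right_inv (hzt t ht)⟩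
        rw [mem_closedBall_zero_iff]
        exact norm_symm_le_of_mem_segment he hP h0 hc hzs hb hzr.le
          ((le_max_left _ _).trans hr.le) hzt t ht
  refine convex_iff_segment_subset.2 fun x hx y hy => ?_
  rw [segment_eq_image']
  rintro _ ⟨t, ht, rfl⟩
  have := main _ (e.map_target hy) _ (e.map_target hx) t ht
  rwa [e.right_inv hx, e.right_inv hy] at this

end Convexity

/-- The Clunie–Sheil-Small shear construction: if `φ = h - g` is univalent with convex image
and `g' = ω h'` with `|ω| < 1`, encoded as `0 < Re ((h' + g') / (h' - g'))`, then `h + conj g` is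
univalent with image convex in the horizontal direction. -/
theorem injOn_and_isCHD_shear {e : OpenPartialHomeomorph ℂ ℂ} {P h g h' g' : ℂ → ℂ}
    (hconv : Convex ℝ e.target) (he : ∀ z ∈ e.source, HasDerivAt e (P z)⁻¹ z)
    (h0 : ∀ z ∈ e.source, P z ≠ 0)
    (hh : ∀ z ∈ e.source, HasDerivAt h (h' z) z) (hg : ∀ z ∈ e.source, HasDerivAt g (g' z) z)
    (heq : ∀ z, e z = h z - g z) (hω : ∀ z ∈ e.source, 0 < ((h' z + g' z) * P z).re) :
    InjOn (fun z => h z + (starRingEnd ℂ) (g z)) e.source ∧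
      IsCHD ((fun z => h z + (starRingEnd ℂ) (g z)) '' e.source) := by
  have him : ∀ z, (h z + (starRingEnd ℂ) (g z)).im = (e z).im := fun z => by simp [heq]; ring
  have hlt : ∀ a ∈ e.source, ∀ b ∈ e.source, (e a).im = (e b).im → (e a).re < (e b).re →
      (h a + (starRingEnd ℂ) (g a)).re < (h b + (starRingEnd ℂ) (g b)).re := by
    intro a ha b hb hi hre
    set T : ℝ := (e b).re - (e a).re with hT
    have hd : e b - e a = (T : ℂ) := by
      apply Complex.ext <;> simp [hT, hi]
    have hseg : ∀ t ∈ Icc (0 : ℝ) 1, e a + (t : ℂ) * (e b - e a) ∈ e.target := fun t ht => by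
      simpa using hconv.add_smul_sub_mem (e.map_source ha) (e.map_source hb) ht
    set γ : ℝ → ℂ := fun s => e.symm (e a + (s : ℂ) * (e b - e a)) with hγ
    have hu : ∀ t ∈ Icc (0 : ℝ) 1, HasDerivAt (fun s => (h (γ s) + g (γ s)).re)
        (T * ((h' (γ t) + g' (γ t)) * P (γ t)).re) t := by
      intro t ht
      have hs := e.map_target (hseg t ht)
      have h1 : HasDerivAt γ (P (γ t) * (e b - e a)) t :=
        hasDerivAt_symm_line he h0 _ _ (hseg t ht)
      have h2 := reCLM.hasFDerivAt.comp_hasDerivAt t (((hh _ hs).add (hg _ hs)).comp t h1)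
      refine HasDerivAt.congr_deriv h2 ?_
      rw [reCLM_apply, ← re_ofReal_mul, hd, ← mul_assoc, mul_comm _ (T : ℂ)]
      simp only [hγ, hd]
    have := sub_pos_of_hasDerivAt_pos hu fun t ht =>
      mul_pos (sub_pos.2 hre) (hω _ (e.map_target (hseg t ht)))
    simpa [hγ, e.left_inv ha, e.left_inv hb] using this
  refine ⟨fun a ha b hb hab => ?_, fun t => ?_⟩
  · have hi : (e a).im = (e b).im := by
      rw [← him, ← him]
      exact congrArg im hab
    have hre : (h a + (starRingEnd ℂ) (g a)).re = (h b + (starRingEnd ℂ) (g b)).re :=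
      congrArg re hab
    refine e.injOn ha hb (Complex.ext ?_ hi)
    rcases lt_trichotomy (e a).re (e b).re with hl | hl | hl
    · exact absurd hre (hlt a ha b hb hi hl).ne
    · exact hl
    · exact absurd hre (hlt b hb a ha hi.symm hl).ne'
  · have himage : {z | z ∈ (fun z => h z + (starRingEnd ℂ) (g z)) '' e.source ∧ z.im = t} =
        (fun z => h z + (starRingEnd ℂ) (g z)) ∘ e.symm '' (e.target ∩ {w | w.im = t}) := by
      ext w
      constructor
      · rintro ⟨⟨z, hz, rfl⟩, hw⟩
        refine ⟨e z, ⟨e.map_source hz, (him z).symm.trans hw⟩, ?_⟩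
        simp [e.left_inv hz]
      · rintro ⟨v, ⟨hv, hvt⟩, rfl⟩
        refine ⟨⟨e.symm v, e.map_target hv, rfl⟩, ?_⟩
        rw [Function.comp_apply, him, e.right_inv hv]
        exact hvt
    rw [himage]
    have hline : Convex ℝ {w : ℂ | w.im = t} := convex_hyperplane imLm.isLinear t
    refine (hconv.inter hline).isPreconnected.image _ ?_
    have hf : ContinuousOn (fun z => h z + (starRingEnd ℂ) (g z)) e.source := fun z hz =>
      ((hh z hz).continuousAt.add
        (continuous_conj.continuousAt.comp (hg z hz).continuousAt)).continuousWithinAt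
    exact (hf.comp e.continuousOn_symm e.mapsTo_symm).mono inter_subset_left

theorem re_one_add_div_one_sub_pos {w : ℂ} (hw : ‖w‖ < 1) : 0 < ((1 + w) / (1 - w)).re := by
  have hne : 1 - w ≠ 0 := sub_ne_zero.2 fun h => by simp [← h] at hw
  have h1 : normSq w < 1 := by
    rw [normSq_eq_norm_sq]
    nlinarith [norm_nonneg w]
  rw [normSq_apply] at h1
  rw [div_re, ← add_div]
  refine div_pos ?_ (normSq_pos.2 hne)
  simp
  nlinarith

theorem re_cpow_pos {w : ℂ} (hw : 0 < w.re) {s : ℝ} (hs : |s| ≤ 1) :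
    0 < (w ^ (s : ℂ)).re := by
  have hw0 : w ≠ 0 := fun h => by simp [h] at hw
  have harg : |w.arg| < π / 2 := abs_arg_lt_pi_div_two_iff.2 (Or.inl hw)
  rw [cpow_def_of_ne_zero hw0, exp_re]
  refine mul_pos (Real.exp_pos _) (Real.cos_pos_of_mem_Ioo (abs_lt.1 ?_))
  rw [im_mul_ofReal, log_im, abs_mul]
  nlinarith [abs_nonneg w.arg]

theorem polygon_shear_z2n_univalent_CHD
    (n : ℕ) (hn : 3 ≤ n) :
    let h : ℂ → ℂ := fun z =>
      segInt (fun ζ => (1 - ζ ^ n) ^ (-(2 / (n : ℂ))) * (1 - ζ ^ (2 * n))⁻¹) z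
    let g : ℂ → ℂ := fun z =>
      segInt (fun ζ => ζ ^ (2 * n) * (1 - ζ ^ n) ^ (-(2 / (n : ℂ))) * (1 - ζ ^ (2 * n))⁻¹) z
    let f : ℂ → ℂ := fun z => h z + (starRingEnd ℂ) (g z)
    Set.InjOn f unitDisk ∧ IsCHD (f '' unitDisk) := by
  intro h g f
  have hn0 : (n : ℂ) ≠ 0 := by exact_mod_cast (by omega : n ≠ 0)
  have hpow : ∀ z ∈ unitDisk, ∀ m, m ≠ 0 → ‖z ^ m‖ < 1 := by
    intro z hz m hm
    rw [norm_pow]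
    exact pow_lt_one₀ (norm_nonneg z) (by simpa [unitDisk] using hz) hm
  have hre : ∀ z ∈ unitDisk, 0 < (1 - z ^ n).re := by
    intro z hz
    rw [sub_re, one_re, sub_pos]
    exact (re_le_norm _).trans_lt (hpow z hz n (by omega))
  have hslit : ∀ z ∈ unitDisk, 1 - z ^ n ∈ slitPlane := fun z hz => Or.inl (hre z hz)
  have hne : ∀ z ∈ unitDisk, 1 - z ^ n ≠ 0 := fun z hz => slitPlane_ne_zero (hslit z hz)
  have hne2 : ∀ z ∈ unitDisk, 1 - z ^ (2 * n) ≠ 0 := fun z hz =>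
    sub_ne_zero.2 fun heq => by
      have := hpow z hz (2 * n) (by omega)
      simp [← heq] at this
  set P : ℂ → ℂ := fun z => (1 - z ^ n) ^ (2 / (n : ℂ)) with hPdef
  set P' : ℂ → ℂ := fun z => 2 / (n : ℂ) * (1 - z ^ n) ^ (2 / (n : ℂ) - 1) *
    (-((n : ℂ) * z ^ (n - 1))) with hP'def
  have hP : ∀ z ∈ unitDisk, HasDerivAt P (P' z) z := fun z hz =>
    ((hasDerivAt_pow n z).const_sub 1).cpow_const (hslit z hz)
  have hP0 : ∀ z ∈ unitDisk, P z ≠ 0 := fun z hz => by simp [hPdef, cpow_eq_zero_iff, hne z hz]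
  have hPinv : ∀ z, (P z)⁻¹ = (1 - z ^ n) ^ (-(2 / (n : ℂ))) := fun z => (cpow_neg _ _).symm
  have hPinvd : DifferentiableOn ℂ (fun z => (1 - z ^ n) ^ (-(2 / (n : ℂ)))) unitDisk := by
    intro z hz
    simp_rw [← hPinv]
    exact ((hP z hz).inv (hP0 z hz)).differentiableAt.differentiableWithinAt
  have hQ : DifferentiableOn ℂ (fun z : ℂ => (1 - z ^ (2 * n))⁻¹) unitDisk :=
    DifferentiableOn.inv (by fun_prop) hne2
  have hh : ∀ z ∈ unitDisk, HasDerivAt h ((P z)⁻¹ * (1 - z ^ (2 * n))⁻¹) z := fun z hz => by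
    rw [hPinv]
    exact hasDerivAt_segInt (hPinvd.mul hQ) hz
  have hg : ∀ z ∈ unitDisk, HasDerivAt g (z ^ (2 * n) * (P z)⁻¹ * (1 - z ^ (2 * n))⁻¹) z :=
    fun z hz => by
      rw [hPinv]
      exact hasDerivAt_segInt
        (((differentiable_pow (2 * n)).differentiableOn.mul hPinvd).mul hQ) hz
  have hφ : ∀ z ∈ unitDisk, HasDerivAt (fun z => h z - g z) (P z)⁻¹ z := fun z hz => by
    refine ((hh z hz).sub (hg z hz)).congr_deriv ?_
    have := hne2 z hz
    field_simp
  have hinj : InjOn (fun z => h z - g z) unitDisk := by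
    refine injOn_of_re_deriv_pos (convex_ball 0 1) hφ fun z hz => ?_
    rw [hPinv, show -(2 / (n : ℂ)) = ((-(2 / (n : ℝ)) : ℝ) : ℂ) by push_cast; ring]
    refine re_cpow_pos (hre z hz) ?_
    have : (3 : ℝ) ≤ n := by exact_mod_cast hn
    rw [abs_neg, abs_of_nonneg (by positivity), div_le_one (by positivity)]
    linarith
  have hc : ∀ z ∈ unitDisk, 0 < (1 - z * (P' z / P z)).re := by
    intro z hz
    convert re_one_add_div_one_sub_pos (hpow z hz n (by omega)) using 2
    have h1 := hne z hz
    have h2 : (1 - z ^ n) ^ (2 / (n : ℂ)) ≠ 0 := hP0 z hz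
    have h3 : z * z ^ (n - 1) = z ^ n := by rw [← pow_succ', Nat.sub_add_cancel (by omega)]
    simp only [hP'def, hPdef]
    rw [cpow_sub _ _ h1, cpow_one]
    field_simp
    linear_combination 2 * h3
  obtain ⟨e, hsrc, -, hfun⟩ := exists_openPartialHomeomorph_of_injOn Metric.isOpen_ball hφ
    (fun z hz => inv_ne_zero (hP0 z hz)) hinj
  change e.source = unitDisk at hsrc
  rw [← hsrc] at hP hP0 hh hg hφ hc ⊢
  rw [← hfun] at hφ
  refine injOn_and_isCHD_shear (convex_target_of_re_pos hsrc hφ hP hP0 hc) hφ hP0 hh hg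
    (fun z => by rw [hfun]) fun z hz => ?_
  convert re_one_add_div_one_sub_pos (hpow z (hsrc ▸ hz) (2 * n) (by omega)) using 2
  have h1 := hP0 z hz
  have h2 := hne2 z (hsrc ▸ hz)
  field_simp
end
end

section
/- Let n ≥ 1 be an integer. For every z ∈ 𝔻, the Weierstrass–Enneper height function ψ(z) = ∫₀^z ζⁿ (1−ζⁿ)^{−1−2/n} (1+ζⁿ)^{−1} dζ of the shear of the regular n-gon mapping with dilatation ω(z) = z^{2n} satisfies ψ(z) = (z^{n+1}/(n+1)) · F₁(1+1/n, 1+2/n, 1; 2+1/n; zⁿ, −zⁿ), where the integral is along the segment from 0 to z and (1−ζⁿ)^{−1−2/n} denotes the principal power. -/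
open Complex Set
open scoped Real

noncomputable section

theorem poch_succ (a : ℂ) (m : ℕ) : poch a (m + 1) = poch a m * (a + m) :=
  Finset.prod_range_succ _ _

theorem poch_succ' (a : ℂ) (m : ℕ) : poch a (m + 1) = a * poch (a + 1) m := by
  simp [poch, Finset.prod_range_succ', mul_comm, add_assoc, add_comm (1 : ℂ)]

theorem poch_eq_ascPochhammer_eval (a : ℂ) (m : ℕ) : poch a m = (ascPochhammer ℂ m).eval a := by
  induction m with
  | zero => simp [poch]
  | succ m ih => rw [poch_succ, ih, ascPochhammer_succ_eval]

theorem poch_one (m : ℕ) : poch 1 m = m.factorial := by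
  rw [poch_eq_ascPochhammer_eval, ascPochhammer_eval_one]

theorem choose_add_natCast_sub_one (b : ℂ) (k : ℕ) :
    Ring.choose (b + k - 1) k = poch b k / k.factorial := by
  rw [← Ring.multichoose_eq, eq_div_iff (by exact_mod_cast k.factorial_ne_zero), mul_comm,
    ← nsmul_eq_mul, Ring.factorial_nsmul_multichoose_eq_ascPochhammer,
    Polynomial.ascPochhammer_smeval_eq_eval, poch_eq_ascPochhammer_eval]

theorem poch_ne_zero_of_re_pos {a : ℂ} (ha : 0 < a.re) (m : ℕ) : poch a m ≠ 0 := by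
  refine Finset.prod_ne_zero_iff.2 fun i _ h => ?_
  have h' := congrArg Complex.re h
  simp only [add_re, natCast_re, zero_re] at h'
  have : (0 : ℝ) ≤ i := i.cast_nonneg
  linarith

theorem poch_div_poch_add_one {a : ℂ} (ha : 0 < a.re) (m : ℕ) :
    poch a m / poch (a + 1) m = a / (a + m) := by
  have h₁ : poch (a + 1) m ≠ 0 := poch_ne_zero_of_re_pos (by simp; linarith) m
  have h₂ : a + m ≠ 0 := fun h =>
    poch_ne_zero_of_re_pos ha (m + 1) (by rw [poch_succ, h, mul_zero])
  rw [div_eq_div_iff h₁ h₂, ← poch_succ, poch_succ']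

/-- The binomial series of `(1 - w) ^ (-b)`, in terms of Pochhammer symbols. -/
theorem hasSum_poch_mul_pow (b : ℂ) {w : ℂ} (hw : ‖w‖ < 1) :
    HasSum (fun k : ℕ => poch b k / (k.factorial : ℂ) * w ^ k) ((1 - w) ^ (-b)) := by
  have hmem : w ∈ Metric.eball (0 : ℂ) 1 := by
    rwa [Metric.mem_eball, edist_zero_right, ← ofReal_norm, ENNReal.ofReal_lt_one]
  have h := (one_div_one_sub_cpow_hasFPowerSeriesOnBall_zero b).hasSum hmem
  simpa [FormalMultilinearSeries.ofScalars_apply_eq, choose_add_natCast_sub_one, cpow_neg,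
    mul_comm]
    using h

theorem summable_norm_poch_mul_pow (b : ℂ) {w : ℂ} (hw : ‖w‖ < 1) :
    Summable fun k : ℕ => ‖poch b k / (k.factorial : ℂ) * w ^ k‖ :=
  (hasSum_poch_mul_pow b hw).summable.norm

theorem integral_pow_appellF1_term (n : ℕ) (hn : 1 ≤ n) (b z : ℂ) (k l : ℕ) :
    ∫ t in (0 : ℝ)..1, z * (((t : ℂ) * z) ^ n * ((poch b k / (k.factorial : ℂ) *
        (((t : ℂ) * z) ^ n) ^ k) * (-((t : ℂ) * z) ^ n) ^ l)) =
      z ^ (n + 1) / ((n : ℂ) + 1) *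
        (poch (1 + 1 / (n : ℂ)) (k + l) * poch b k * poch 1 l /
          (poch (2 + 1 / (n : ℂ)) (k + l) * (k.factorial : ℂ) * (l.factorial : ℂ)) *
            (z ^ n) ^ k * (-z ^ n) ^ l) := by
  have hn₀ : (n : ℂ) ≠ 0 := by exact_mod_cast (by omega : n ≠ 0)
  have hre : 0 < (1 + 1 / (n : ℂ)).re := by
    rw [show 1 + 1 / (n : ℂ) = ((1 + 1 / (n : ℝ) : ℝ) : ℂ) by push_cast; rfl, ofReal_re]
    positivity
  have hratio := poch_div_poch_add_one hre (k + l)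
  rw [show 1 + 1 / (n : ℂ) + 1 = 2 + 1 / (n : ℂ) by ring] at hratio
  have hF : ∀ t : ℝ, z * (((t : ℂ) * z) ^ n * ((poch b k / (k.factorial : ℂ) *
        (((t : ℂ) * z) ^ n) ^ k) * (-((t : ℂ) * z) ^ n) ^ l)) =
      (z ^ (n + 1) * (poch b k / (k.factorial : ℂ)) * (z ^ n) ^ k * (-z ^ n) ^ l) *
        ((t ^ (n * (k + l + 1)) : ℝ) : ℂ) := by
    intro t
    simp only [neg_pow (_ ^ n), ← pow_mul, mul_pow, ofReal_pow]
    ring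
  have hd₁ : (n : ℂ) + 1 ≠ 0 := by exact_mod_cast n.succ_ne_zero
  have hd₂ : (n : ℂ) * (k + l + 1) + 1 ≠ 0 := by
    exact_mod_cast (n * (k + l + 1)).succ_ne_zero
  have hl : (l.factorial : ℂ) ≠ 0 := by exact_mod_cast l.factorial_ne_zero
  have hquot : (1 + 1 / (n : ℂ)) / (1 + 1 / (n : ℂ) + ((k + l : ℕ) : ℂ)) =
      ((n : ℂ) + 1) / ((n : ℂ) * (k + l + 1) + 1) := by
    have hd₃ : 1 + 1 / (n : ℂ) + ((k + l : ℕ) : ℂ) ≠ 0 := by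
      intro h
      apply hd₂
      push_cast at h
      field_simp at h
      linear_combination h
    rw [div_eq_div_iff hd₃ hd₂]
    push_cast
    field_simp
    ring
  rw [hquot] at hratio
  simp only [hF]
  rw [intervalIntegral.integral_const_mul, intervalIntegral.integral_ofReal, integral_pow,
    poch_one]
  calc _ = z ^ (n + 1) / ((n : ℂ) + 1) * (((n : ℂ) + 1) / ((n : ℂ) * (k + l + 1) + 1) *
        (poch b k / (k.factorial : ℂ)) * (z ^ n) ^ k * (-z ^ n) ^ l) := by
        push_cast
        simp only [one_pow, zero_pow (Nat.succ_ne_zero _), sub_zero]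
        field_simp
    _ = _ := by
        rw [← hratio]
        field_simp

theorem hasSum_integral_poch_mul_geometric (n : ℕ) (hn : 1 ≤ n) (b : ℂ) {z : ℂ} (hz : ‖z‖ < 1) :
    HasSum (fun p : ℕ × ℕ => ∫ t in (0 : ℝ)..1, z * (((t : ℂ) * z) ^ n *
        ((poch b p.1 / (p.1.factorial : ℂ) * (((t : ℂ) * z) ^ n) ^ p.1) *
          (-((t : ℂ) * z) ^ n) ^ p.2)))
      (∫ t in (0 : ℝ)..1, z * (((t : ℂ) * z) ^ n * (1 - ((t : ℂ) * z) ^ n) ^ (-b) *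
        (1 + ((t : ℂ) * z) ^ n)⁻¹)) := by
  have hzn : ‖z ^ n‖ < 1 := by
    rw [norm_pow]
    exact pow_lt_one₀ (norm_nonneg _) hz (by omega)
  have hgeom : Summable fun l : ℕ => ‖(-z ^ n) ^ l‖ := by
    simpa only [norm_pow, norm_neg] using
      summable_geometric_of_lt_one (norm_nonneg (z ^ n)) hzn
  have hB : Summable fun p : ℕ × ℕ =>
      ‖poch b p.1 / (p.1.factorial : ℂ) * (z ^ n) ^ p.1‖ * ‖(-z ^ n) ^ p.2‖ :=
    (summable_norm_poch_mul_pow b hzn).mul_of_nonneg hgeom (fun _ => norm_nonneg _)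
      (fun _ => norm_nonneg _)
  have htz : ∀ t ∈ uIoc (0 : ℝ) 1, ‖(t : ℂ) * z‖ ≤ ‖z‖ := by
    intro t ht
    rw [uIoc_of_le zero_le_one] at ht
    rw [norm_mul, norm_real, Real.norm_of_nonneg ht.1.le]
    exact mul_le_of_le_one_left (norm_nonneg _) ht.2
  refine intervalIntegral.hasSum_integral_of_dominated_convergence
    (fun p _ => ‖poch b p.1 / (p.1.factorial : ℂ) * (z ^ n) ^ p.1‖ * ‖(-z ^ n) ^ p.2‖)
    (fun p => Continuous.aestronglyMeasurable (by fun_prop))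
    (fun p => .of_forall fun t ht => ?_) (.of_forall fun _ _ => hB)
    intervalIntegrable_const (.of_forall fun t ht => ?_)
  · have h₁ : ‖(t : ℂ) * z‖ ^ n ≤ ‖z‖ ^ n := pow_le_pow_left₀ (norm_nonneg _) (htz t ht) n
    have h₂ : ‖(t : ℂ) * z‖ ^ n ≤ 1 :=
      pow_le_one₀ (norm_nonneg _) ((htz t ht).trans hz.le)
    generalize poch b p.1 / (p.1.factorial : ℂ) = c
    generalize (t : ℂ) * z = w at h₁ h₂
    calc _ = ‖z‖ * (‖w‖ ^ n * ((‖c‖ * (‖w‖ ^ n) ^ p.1) * (‖w‖ ^ n) ^ p.2)) := by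
          simp only [norm_mul, norm_pow, norm_neg]
      _ ≤ 1 * (1 * ((‖c‖ * (‖z‖ ^ n) ^ p.1) * (‖z‖ ^ n) ^ p.2)) := by
          gcongr
      _ = _ := by simp only [norm_mul, norm_pow, norm_neg, one_mul]
  · have hw : ‖((t : ℂ) * z) ^ n‖ < 1 := by
      rw [norm_pow]
      exact pow_lt_one₀ (norm_nonneg _) ((htz t ht).trans_lt hz) (by omega)
    generalize ((t : ℂ) * z) ^ n = w at hw
    have hs₁ := hasSum_poch_mul_pow b hw
    have hs₂ := hasSum_geometric_of_norm_lt_one (ξ := -w) (by rwa [norm_neg])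
    have hprod : Summable fun p : ℕ × ℕ =>
        (poch b p.1 / (p.1.factorial : ℂ) * w ^ p.1) * (-w) ^ p.2 :=
      summable_mul_of_summable_norm (f := fun k : ℕ => poch b k / (k.factorial : ℂ) * w ^ k)
        (g := fun l : ℕ => (-w) ^ l) (summable_norm_poch_mul_pow b hw) hs₂.summable.norm
    have hs := ((hs₁.mul hs₂ hprod).mul_left w).mul_left z
    rw [sub_neg_eq_add, ← mul_assoc w] at hs
    exact hs

theorem minimal_surface_height_z2n_appell
    (n : ℕ) (hn : 1 ≤ n) (z : ℂ) (hz : z ∈ unitDisk) :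
    segInt (fun ζ => ζ ^ n * (1 - ζ ^ n) ^ (-1 - 2 / (n : ℂ)) * (1 + ζ ^ n)⁻¹) z =
      z ^ (n + 1) / ((n : ℂ) + 1) *
        appellF1 (1 + 1 / (n : ℂ)) (1 + 2 / (n : ℂ)) 1 (2 + 1 / (n : ℂ)) (z ^ n) (-z ^ n) := by
  have hz₁ : ‖z‖ < 1 := by simpa [unitDisk] using hz
  have hsum := hasSum_integral_poch_mul_geometric n hn (1 + 2 / (n : ℂ)) hz₁
  simp only [integral_pow_appellF1_term n hn] at hsum
  rw [segInt, show (-1 - 2 / (n : ℂ)) = -(1 + 2 / (n : ℂ)) by ring, ← hsum.tsum_eq,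
    tsum_mul_left]
  by_cases hz₀ : z = 0
  · simp [hz₀]
  have hfac : z ^ (n + 1) / ((n : ℂ) + 1) ≠ 0 :=
    div_ne_zero (pow_ne_zero _ hz₀) (by exact_mod_cast n.succ_ne_zero)
  rw [((summable_mul_left_iff hfac).1 hsum.summable).tsum_prod]
  rfl
end
end
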